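/- (Remark 1.) Let π = (s_1, …, s_V) be a detecting order and 1 ≤ k ≤ V−1. If γ_{s_k}^{(D_{k−1})} ≤ γ_{s_{k+1}}^{(D_{k−1})} (i.e., positions k and k+1 satisfy the necessary optimality condition), then the order π' obtained from π by swapping s_k and s_{k+1} satisfies Θ_{π'} ≤ Θ_π, and hence the variance of the detecting SINR sequence satisfies V_{π'} ≤ V_π. -/

import Mathlib

open Finset

/-- The set of resources connected to user `v` in the factor graph `A`. -/
def Fv {F V : ℕ} (A : Fin F → Fin V → Bool) (v : Fin V) : Finset (Fin F) :=
  Finset.univ.filter (fun f => A f v = true)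

/-- The degree `d_f` of resource `f`: the number of users connected to it. -/
def deg {F V : ℕ} (A : Fin F → Fin V → Bool) (f : Fin F) : ℕ :=
  (Finset.univ.filter (fun v => A f v = true)).card

/-- The pruned degree `d_f^{(D)}` of resource `f` after the users in `D` are detected. -/
def prunedDeg {F V : ℕ} (A : Fin F → Fin V → Bool) (D : Finset (Fin V)) (f : Fin F) : ℕ :=
  (Finset.univ.filter (fun v => v ∉ D ∧ A f v = true)).card

/-- The instantaneous SINR `γ_v^{(D)}` of an undetected user `v`. -/
noncomputable def gamma {F V : ℕ} (lam : ℝ) (A : Fin F → Fin V → Bool)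
    (D : Finset (Fin V)) (v : Fin V) : ℝ :=
  ∑ f ∈ Fv A v, 1 / (((prunedDeg A D f : ℝ) - 1) + lam)

/-- The detected set `D_{k-1} = {s_1, …, s_{k-1}}` of users occupying positions before `k`
in the detecting order `π` (position `k` maps to user `π k`). -/
def Dset {V : ℕ} (π : Equiv.Perm (Fin V)) (k : Fin V) : Finset (Fin V) :=
  (Finset.univ.filter (fun j => j < k)).image π

/-- The detecting SINR `γ_{s_k} = γ_{s_k}^{(D_{k-1})}` at position `k` of the order `π`. -/
noncomputable def detSINR {F V : ℕ} (lam : ℝ) (A : Fin F → Fin V → Bool)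
    (π : Equiv.Perm (Fin V)) (k : Fin V) : ℝ :=
  gamma lam A (Dset π k) (π k)

/-- `Θ_π`, the sum of squared detecting SINRs. -/
noncomputable def Theta {F V : ℕ} (lam : ℝ) (A : Fin F → Fin V → Bool)
    (π : Equiv.Perm (Fin V)) : ℝ :=
  ∑ k : Fin V, (detSINR lam A π k) ^ 2

/-- `M_π`, the mean of the detecting SINR sequence. -/
noncomputable def Mmean {F V : ℕ} (lam : ℝ) (A : Fin F → Fin V → Bool)
    (π : Equiv.Perm (Fin V)) : ℝ :=
  (1 / (V : ℝ)) * ∑ k : Fin V, detSINR lam A π k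

/-- `V_π`, the variance of the detecting SINR sequence. -/
noncomputable def Vπ {F V : ℕ} (lam : ℝ) (A : Fin F → Fin V → Bool)
    (π : Equiv.Perm (Fin V)) : ℝ :=
  (1 / (V : ℝ)) * (∑ k : Fin V, (detSINR lam A π k) ^ 2) - (Mmean lam A π) ^ 2

theorem prunedDeg_insert {F V : ℕ} (A : Fin F → Fin V → Bool) {D : Finset (Fin V)}
    {u : Fin V} (hu : u ∉ D) (f : Fin F) :
    prunedDeg A (insert u D) f + (if A f u = true then 1 else 0) = prunedDeg A D f := by
  unfold prunedDeg
  split_ifs with h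
  · rw [← Finset.card_insert_of_notMem (a := u) (by simp)]
    congr 1
    ext v
    simp only [Finset.mem_insert, Finset.mem_filter, Finset.mem_univ, true_and]
    grind
  · rw [add_zero]
    congr 1
    ext v
    simp only [Finset.mem_insert, Finset.mem_filter, Finset.mem_univ, true_and]
    grind

/-- The increase of the SINR of `w` caused by detecting `u`, which is symmetric in `u` and `w`. -/
noncomputable def sinrGain {F V : ℕ} (lam : ℝ) (A : Fin F → Fin V → Bool)
    (D : Finset (Fin V)) (u w : Fin V) : ℝ :=
  ∑ f, if A f u = true ∧ A f w = true then
    1 / (((prunedDeg A D f : ℝ) - 2) + lam) - 1 / (((prunedDeg A D f : ℝ) - 1) + lam) else 0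

theorem sinrGain_comm {F V : ℕ} (lam : ℝ) (A : Fin F → Fin V → Bool)
    (D : Finset (Fin V)) (u w : Fin V) : sinrGain lam A D u w = sinrGain lam A D w u := by
  simp only [sinrGain, and_comm]

theorem gamma_insert {F V : ℕ} (lam : ℝ) (A : Fin F → Fin V → Bool) {D : Finset (Fin V)}
    {u : Fin V} (hu : u ∉ D) (w : Fin V) :
    gamma lam A (insert u D) w = gamma lam A D w + sinrGain lam A D u w := by
  simp only [gamma, Fv, sinrGain, Finset.sum_filter]
  rw [← Finset.sum_add_distrib]
  refine Finset.sum_congr rfl fun f _ => ?_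
  rw [← prunedDeg_insert A hu f]
  by_cases hfw : A f w = true <;> by_cases hfu : A f u = true <;> simp [hfw, hfu]
  ring

theorem two_le_prunedDeg {F V : ℕ} {A : Fin F → Fin V → Bool} {D : Finset (Fin V)}
    {u w : Fin V} {f : Fin F} (hu : u ∉ D) (hw : w ∉ D) (huw : u ≠ w)
    (hfu : A f u = true) (hfw : A f w = true) : 2 ≤ prunedDeg A D f := by
  rw [← Finset.card_pair huw]
  refine Finset.card_le_card fun v hv => ?_
  rcases Finset.mem_insert.1 hv with rfl | hv
  · simp [hu, hfu]
  · simp_all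

theorem sinrGain_nonneg {F V : ℕ} {lam : ℝ} (hlam : 0 < lam) (A : Fin F → Fin V → Bool)
    {D : Finset (Fin V)} {u w : Fin V} (hu : u ∉ D) (hw : w ∉ D) (huw : u ≠ w) :
    0 ≤ sinrGain lam A D u w := by
  refine Finset.sum_nonneg fun f _ => ?_
  split_ifs with h
  · have hd : (2 : ℝ) ≤ prunedDeg A D f := by
      exact_mod_cast two_le_prunedDeg hu hw huw h.1 h.2
    exact sub_nonneg.2 (one_div_le_one_div_of_le (by linarith) (by linarith))
  · rfl

theorem mem_Dset {V : ℕ} (π : Equiv.Perm (Fin V)) (k v : Fin V) :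
    v ∈ Dset π k ↔ π.symm v < k := by
  simp only [Dset, Finset.mem_image, Finset.mem_filter, Finset.mem_univ, true_and]
  constructor
  · rintro ⟨j, hj, rfl⟩
    simpa using hj
  · exact fun h => ⟨π.symm v, h, by simp⟩

theorem Dset_succ {V : ℕ} (π : Equiv.Perm (Fin V)) {k k' : Fin V} (hk : (k' : ℕ) = k + 1) :
    Dset π k' = insert (π k) (Dset π k) := by
  ext v
  rw [Finset.mem_insert, mem_Dset, mem_Dset, ← Equiv.symm_apply_eq, Fin.lt_def, Fin.lt_def,
    Fin.ext_iff]
  omega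

theorem Dset_mul_swap {V : ℕ} (π : Equiv.Perm (Fin V)) {k k' j : Fin V}
    (hk : (k' : ℕ) = k + 1) (hj : j ≠ k') :
    Dset (π * Equiv.swap k k') j = Dset π j := by
  ext v
  have hswap : (π * Equiv.swap k k').symm v = Equiv.swap k k' (π.symm v) := rfl
  rw [mem_Dset, mem_Dset, hswap, Equiv.swap_apply_def]
  simp only [Fin.lt_def, Fin.ext_iff, ne_eq] at *
  split_ifs <;> omega

theorem detSINR_mul_swap_of_ne {F V : ℕ} (lam : ℝ) (A : Fin F → Fin V → Bool)
    (π : Equiv.Perm (Fin V)) {k k' j : Fin V} (hk : (k' : ℕ) = k + 1) (hj : j ≠ k)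
    (hj' : j ≠ k') :
    detSINR lam A (π * Equiv.swap k k') j = detSINR lam A π j := by
  simp only [detSINR, Dset_mul_swap π hk hj', Equiv.Perm.mul_apply,
    Equiv.swap_apply_of_ne_of_ne hj hj']

/-- Swapping two consecutive users changes a sum over the detecting SINRs only in the terms of
these two users. -/
theorem sum_detSINR_mul_swap_sub {F V : ℕ} (lam : ℝ) (A : Fin F → Fin V → Bool)
    (π : Equiv.Perm (Fin V)) {k k' : Fin V} (hk : (k' : ℕ) = k + 1) (φ : ℝ → ℝ) :
    ∑ j, φ (detSINR lam A (π * Equiv.swap k k') j) - ∑ j, φ (detSINR lam A π j) =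
      φ (gamma lam A (Dset π k) (π k')) +
        φ (gamma lam A (Dset π k) (π k) + sinrGain lam A (Dset π k) (π k) (π k')) -
      (φ (gamma lam A (Dset π k) (π k)) +
        φ (gamma lam A (Dset π k) (π k') + sinrGain lam A (Dset π k) (π k) (π k'))) := by
  have hne : k ≠ k' := fun h => by simp [h] at hk
  have hu : π k ∉ Dset π k := by simp [mem_Dset]
  have hw : π k' ∉ Dset π k := by simp [mem_Dset, Fin.le_def, hk]
  rw [← Finset.sum_sub_distrib, ← Finset.sum_subset (Finset.subset_univ {k, k'}),
    Finset.sum_pair hne]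
  · simp only [detSINR, Dset_succ _ hk, Dset_mul_swap π hk hne, Equiv.Perm.mul_apply,
      Equiv.swap_apply_left, Equiv.swap_apply_right, gamma_insert lam A hu, gamma_insert lam A hw,
      sinrGain_comm lam A _ (π k') (π k)]
    ring
  · intro j _ hj
    simp only [Finset.mem_insert, Finset.mem_singleton, not_or] at hj
    rw [detSINR_mul_swap_of_ne lam A π hk hj.1 hj.2, sub_self]

theorem Theta_mul_swap_le {F V : ℕ} {lam : ℝ} (hlam : 0 < lam) (A : Fin F → Fin V → Bool)
    (π : Equiv.Perm (Fin V)) {k k' : Fin V} (hk : (k' : ℕ) = k + 1)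
    (h : gamma lam A (Dset π k) (π k) ≤ gamma lam A (Dset π k) (π k')) :
    Theta lam A (π * Equiv.swap k k') ≤ Theta lam A π := by
  have hsum := sum_detSINR_mul_swap_sub lam A π hk (· ^ 2)
  have hne : k ≠ k' := fun h => by simp [h] at hk
  have hgain : 0 ≤ sinrGain lam A (Dset π k) (π k) (π k') :=
    sinrGain_nonneg hlam A (by simp [mem_Dset]) (by simp [mem_Dset, Fin.le_def, hk])
      (π.injective.ne hne)
  unfold Theta
  nlinarith [mul_nonneg hgain (sub_nonneg.2 h)]

theorem Mmean_mul_swap {F V : ℕ} (lam : ℝ) (A : Fin F → Fin V → Bool)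
    (π : Equiv.Perm (Fin V)) {k k' : Fin V} (hk : (k' : ℕ) = k + 1) :
    Mmean lam A (π * Equiv.swap k k') = Mmean lam A π := by
  have hsum := sum_detSINR_mul_swap_sub lam A π hk id
  simp only [id] at hsum
  unfold Mmean
  congr 1
  linarith

/-- Remark 1: if positions `k`, `k+1` satisfy the necessary optimality
condition `γ_{s_k}^{(D_{k−1})} ≤ γ_{s_{k+1}}^{(D_{k−1})}`, then swapping them does not
increase Θ, and hence does not increase the variance. -/
theorem stmt_10 {F V : ℕ} (lam : ℝ) (hlam : 0 < lam) (A : Fin F → Fin V → Bool)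
    (π : Equiv.Perm (Fin V)) (k : Fin V) (hk : (k : ℕ) + 1 < V) :
    let k' : Fin V := ⟨(k : ℕ) + 1, hk⟩
    let π' : Equiv.Perm (Fin V) := π * Equiv.swap k k'
    gamma lam A (Dset π k) (π k) ≤ gamma lam A (Dset π k) (π k') →
      Theta lam A π' ≤ Theta lam A π ∧ Vπ lam A π' ≤ Vπ lam A π := by
  intro k' π' h
  have hΘ : Theta lam A π' ≤ Theta lam A π := Theta_mul_swap_le hlam A π rfl h
  refine ⟨hΘ, ?_⟩
  unfold Vπ
  rw [show Mmean lam A π' = Mmean lam A π from Mmean_mul_swap lam A π rfl]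
  exact sub_le_sub_right (mul_le_mul_of_nonneg_left hΘ (by positivity)) _
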